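/- Let Ω ⊆ ℝ³ be open, let ρ : Ω → ℝ and the vector fields u, A : Ω → ℝ³ be smooth, let m > 0 and q be real constants, and define the canonical momentum field p = m·u + q·A. Fix x₀ ∈ Ω and assume ρ(x₀) > 0 and (∇×p)(x₀) ≠ 0. Then there exist an open neighborhood U ⊆ Ω of x₀ and smooth functions ρ₁, ρ₂, θ₁, θ₂ : U → ℝ such that ρ₁ + ρ₂ = ρ on U, ρ₁ > 0 and ρ₂ > 0 on U, and (ρ₁/ρ)·∇(θ₁ − θ₂) + ∇θ₂ = m·u + q·A on U. -/

import Mathlib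

open Real

noncomputable section

/-- Partial derivative of a scalar function on ℝ³ in the `i`-th coordinate direction. -/
noncomputable def pd (i : Fin 3) (f : (Fin 3 → ℝ) → ℝ) (x : Fin 3 → ℝ) : ℝ :=
  fderiv ℝ f x (Pi.single i 1)

/-- Gradient of a scalar function on ℝ³. -/
noncomputable def grad3 (f : (Fin 3 → ℝ) → ℝ) (x : Fin 3 → ℝ) : Fin 3 → ℝ :=
  fun i => pd i f x

/-- Curl of a vector field on ℝ³. -/
noncomputable def curl3 (v : (Fin 3 → ℝ) → (Fin 3 → ℝ)) (x : Fin 3 → ℝ) : Fin 3 → ℝ :=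
  ![pd 1 (fun y => v y 2) x - pd 2 (fun y => v y 1) x,
    pd 2 (fun y => v y 0) x - pd 0 (fun y => v y 2) x,
    pd 0 (fun y => v y 1) x - pd 1 (fun y => v y 0) x]

open Filter Topology Set
open scoped ContDiff

/-- A function smooth near `x₀` coincides near `x₀` with a globally smooth one. -/
lemma exists_contDiff_eventuallyEq {E F : Type*} [NormedAddCommGroup E] [NormedSpace ℝ E]
    [HasContDiffBump E] [NormedAddCommGroup F] [NormedSpace ℝ F] {f : E → F} {x₀ : E}
    (hf : ∀ᶠ x in 𝓝 x₀, ContDiffAt ℝ ∞ f x) :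
    ∃ g : E → F, ContDiff ℝ ∞ g ∧ g =ᶠ[𝓝 x₀] f := by
  obtain ⟨r, hr, h⟩ := Metric.eventually_nhds_iff_ball.1 hf
  let b : ContDiffBump x₀ := ⟨r / 3, r / 2, by positivity, by linarith⟩
  refine ⟨fun x => b x • f x, contDiff_iff_contDiffAt.2 fun x => ?_, ?_⟩
  · by_cases hx : dist x x₀ < r
    · exact b.contDiffAt.smul (h x hx)
    · refine (contDiffAt_const (c := (0 : F))).congr_of_eventuallyEq ?_
      have : ∀ᶠ y in 𝓝 x, r / 2 < dist y x₀ :=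
        (continuous_id.dist continuous_const).continuousAt.eventually_const_lt
          (by simp only [id]; linarith)
      filter_upwards [this] with y hy
      rw [b.zero_of_le_dist hy.le, zero_smul]
  · filter_upwards [b.eventuallyEq_one] with x hx
    simp [hx]

/-- Inverse function theorem, with smoothness of the inverse in a whole neighborhood. -/
lemma exists_openPartialHomeomorph_contDiffAt_symm {E F : Type*} [NormedAddCommGroup E]
    [NormedSpace ℝ E] [CompleteSpace E] [NormedAddCommGroup F] [NormedSpace ℝ F]
    {f : E → F} {a : E} {f' : E ≃L[ℝ] F}
    (hf : ∀ᶠ x in 𝓝 a, ContDiffAt ℝ ∞ f x) (hf' : HasFDerivAt f (f' : E →L[ℝ] F) a) :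
    ∃ e : OpenPartialHomeomorph E F, ⇑e = f ∧ a ∈ e.source ∧
      ∀ᶠ y in 𝓝 (f a), ContDiffAt ℝ ∞ e.symm y := by
  have ha := hf.self_of_nhds
  have hn : (∞ : WithTop ℕ∞) ≠ 0 := by simp
  let e := ha.toOpenPartialHomeomorph f hf' hn
  have hea : a ∈ e.source := ha.mem_toOpenPartialHomeomorph_source hf' hn
  have hinv : ∀ᶠ x in 𝓝 a, fderiv ℝ f x ∈ range ((↑) : (E ≃L[ℝ] F) → E →L[ℝ] F) := by
    have hc : ContinuousAt (fderiv ℝ f) a := (ha.fderiv_right (m := 0) (by simp)).continuousAt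
    refine hc.eventually_mem ?_
    rw [hf'.fderiv]
    exact f'.nhds
  refine ⟨e, rfl, hea, ?_⟩
  have hsymm : Tendsto e.symm (𝓝 (f a)) (𝓝 a) := e.tendsto_symm hea
  filter_upwards [hsymm.eventually (hf.and hinv), e.open_target.mem_nhds (e.map_source hea)]
    with y ⟨h1, L, hL⟩ h2
  refine e.contDiffAt_symm (f₀' := L) h2 ?_ h1
  rw [hL]
  exact (h1.differentiableAt hn).hasFDerivAt

section Superposition

variable {K : Type*} [TopologicalSpace K] [CompactSpace K]

/-- Pointwise application of a continuous family of continuous linear maps. -/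
noncomputable def pointwiseApplyCLM (K : Type*) [TopologicalSpace K] [CompactSpace K]
    (E F : Type*) [NormedAddCommGroup E] [NormedSpace ℝ E]
    [NormedAddCommGroup F] [NormedSpace ℝ F] :
    C(K, E →L[ℝ] F) →L[ℝ] C(K, E) →L[ℝ] C(K, F) :=
  LinearMap.mkContinuous₂
    (LinearMap.mk₂ ℝ (fun (A : C(K, E →L[ℝ] F)) (γ : C(K, E)) =>
        (⟨fun t => A t (γ t), by fun_prop⟩ : C(K, F)))
      (fun _ _ _ => by ext; simp) (fun _ _ _ => by ext; simp)
      (fun _ _ _ => by ext; simp) (fun _ _ _ => by ext; simp))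
    1 fun A γ => by
      refine (ContinuousMap.norm_le _ (by positivity)).2 fun t => ?_
      rw [one_mul]
      exact ((A t).le_opNorm _).trans
        (mul_le_mul (A.norm_coe_le_norm t) (γ.norm_coe_le_norm t) (by positivity) (by positivity))

/-- Postcomposition with a `C¹` function is differentiable on the space of continuous maps from
a compact space. -/
lemma hasFDerivAt_continuousMap_comp {E F : Type*} [NormedAddCommGroup E] [NormedSpace ℝ E]
    [NormedAddCommGroup F] [NormedSpace ℝ F] (f : C(E, F)) (f' : C(E, E →L[ℝ] F))
    (h : ∀ x, HasFDerivAt f (f' x) x) (γ : C(K, E)) :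
    HasFDerivAt (fun γ : C(K, E) => f.comp γ) (pointwiseApplyCLM K E F (f'.comp γ)) γ := by
  rw [hasFDerivAt_iff_isLittleO_nhds_zero, Asymptotics.isLittleO_iff]
  intro ε hε
  have hc : ContinuousAt (fun η : C(K, E) => f'.comp η) γ :=
    (ContinuousMap.continuous_postcomp f').continuousAt
  have hc' : ∀ᶠ η : C(K, E) in 𝓝 γ, dist (f'.comp η) (f'.comp γ) < ε :=
    hc.eventually_mem (Metric.ball_mem_nhds (f'.comp γ) hε)
  obtain ⟨δ, hδ, hδ'⟩ := Metric.eventually_nhds_iff.1 hc'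
  filter_upwards [Metric.ball_mem_nhds (0 : C(K, E)) hδ] with η hη
  rw [mem_ball_zero_iff] at hη
  refine (ContinuousMap.norm_le _ (by positivity)).2 fun t => ?_
  have ht : ‖η t‖ < δ := (η.norm_coe_le_norm t).trans_lt hη
  have key : ‖f (γ t + η t) - f (γ t) - f' (γ t) (γ t + η t - γ t)‖
      ≤ ε * ‖γ t + η t - γ t‖ := by
    refine Convex.norm_image_sub_le_of_norm_hasFDerivWithin_le' (s := Metric.ball (γ t) δ)
      (fun x _ => (h x).hasFDerivWithinAt) (fun x hx => ?_) (convex_ball _ _)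
      (Metric.mem_ball_self hδ) (by simpa using ht)
    have h1 : dist (γ + ContinuousMap.const K (x - γ t)) γ < δ := by
      rw [dist_eq_norm, add_sub_cancel_left]
      refine (ContinuousMap.norm_lt_iff _ hδ).2 fun s => ?_
      simpa [dist_eq_norm] using hx
    have h2 := (ContinuousMap.dist_apply_le_dist t).trans (hδ' h1).le
    simpa [dist_eq_norm] using h2
  rw [add_sub_cancel_left] at key
  exact key.trans (mul_le_mul_of_nonneg_left (η.norm_coe_le_norm t) hε.le)

universe u in
/-- Postcomposition with a `C^n` function is `C^n` on the space of continuous maps from a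
compact space. -/
lemma contDiff_nat_continuousMap_comp {E : Type u} [NormedAddCommGroup E] [NormedSpace ℝ E]
    (n : ℕ) {F : Type u} [NormedAddCommGroup F] [NormedSpace ℝ F] (f : C(E, F))
    (hf : ContDiff ℝ n f) :
    ContDiff ℝ n (fun γ : C(K, E) => f.comp γ) := by
  induction n generalizing F with
  | zero => exact contDiff_zero.2 (ContinuousMap.continuous_postcomp f)
  | succ n ih =>
    push_cast at hf ⊢
    obtain ⟨f', hf', h⟩ := contDiff_succ_iff_hasFDerivAt.1 hf
    exact contDiff_succ_iff_hasFDerivAt.2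
      ⟨fun γ => pointwiseApplyCLM K E F ((⟨f', hf'.continuous⟩ : C(E, E →L[ℝ] F)).comp γ),
        (ih ⟨f', hf'.continuous⟩ hf').continuousLinearMap_comp (pointwiseApplyCLM K E F),
        hasFDerivAt_continuousMap_comp f ⟨f', hf'.continuous⟩ h⟩

universe u in
/-- Postcomposition with a smooth function is smooth on the space of continuous maps from a
compact space. -/
lemma contDiff_continuousMap_comp {E F : Type u} [NormedAddCommGroup E] [NormedSpace ℝ E]
    [NormedAddCommGroup F] [NormedSpace ℝ F] (f : C(E, F)) (hf : ContDiff ℝ ∞ f) :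
    ContDiff ℝ ∞ (fun γ : C(K, E) => f.comp γ) :=
  contDiff_infty.2 fun n => contDiff_nat_continuousMap_comp n f (contDiff_infty.1 hf n)

end Superposition

section Volterra

variable {E : Type*} [NormedAddCommGroup E]

/-- The continuous extension to `ℝ` of a continuous function on `[-1, 1]`. -/
noncomputable def extendReal (g : C(Icc (-1 : ℝ) 1, E)) : ℝ → E :=
  IccExtend (by norm_num : (-1 : ℝ) ≤ 1) g

lemma extendReal_of_mem (g : C(Icc (-1 : ℝ) 1, E)) {t : ℝ} (ht : t ∈ Icc (-1 : ℝ) 1) :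
    extendReal g t = g ⟨t, ht⟩ := IccExtend_of_mem _ _ ht

lemma continuous_extendReal (g : C(Icc (-1 : ℝ) 1, E)) : Continuous (extendReal g) :=
  g.continuous.Icc_extend'

variable [NormedSpace ℝ E]

/-- The Volterra operator `g ↦ (t ↦ ∫ s in 0..t, g s)` on `C([-1, 1], E)`. -/
noncomputable def volterra (E : Type*) [NormedAddCommGroup E] [NormedSpace ℝ E] [CompleteSpace E] :
    C(Icc (-1 : ℝ) 1, E) →L[ℝ] C(Icc (-1 : ℝ) 1, E) :=
  LinearMap.mkContinuous
    { toFun := fun g => ⟨fun t => ∫ s in (0 : ℝ)..t, extendReal g s,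
        (intervalIntegral.continuous_primitive
          (fun _ _ => (continuous_extendReal g).intervalIntegrable _ _) 0).comp
          continuous_subtype_val⟩
      map_add' := fun g h => by
        ext t
        exact intervalIntegral.integral_add
          ((continuous_extendReal g).intervalIntegrable _ _)
          ((continuous_extendReal h).intervalIntegrable _ _)
      map_smul' := fun c g => by
        ext t
        exact intervalIntegral.integral_smul c _ }
    1 fun g => by
      refine (ContinuousMap.norm_le _ (by positivity)).2 fun t => ?_
      have h := intervalIntegral.norm_integral_le_of_norm_le_const (a := 0) (b := (t : ℝ))
        (f := extendReal g) (C := ‖g‖) fun s _ => g.norm_coe_le_norm _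
      refine h.trans ?_
      rw [sub_zero, one_mul]
      exact mul_le_of_le_one_right (norm_nonneg _) (abs_le.2 t.2)

/-- Multiplication by `σ ∈ [-1, 1]` as a self-map of `[-1, 1]`. -/
def scaleIcc (σ : Icc (-1 : ℝ) 1) : C(Icc (-1 : ℝ) 1, Icc (-1 : ℝ) 1) :=
  ⟨fun t => ⟨σ * t, abs_le.1 (by
    rw [abs_mul]
    exact mul_le_one₀ (abs_le.2 σ.2) (abs_nonneg _) (abs_le.2 t.2))⟩, by fun_prop⟩

lemma smul_volterra_comp_scaleIcc [CompleteSpace E] (g : C(Icc (-1 : ℝ) 1, E))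
    (σ : Icc (-1 : ℝ) 1) :
    (σ : ℝ) • volterra E (g.comp (scaleIcc σ)) = (volterra E g).comp (scaleIcc σ) := by
  ext t
  change (σ : ℝ) • ∫ s in (0 : ℝ)..t, extendReal (g.comp (scaleIcc σ)) s
    = ∫ s in (0 : ℝ)..(σ * t : ℝ), extendReal g s
  have h := intervalIntegral.smul_integral_comp_mul_left (a := 0) (b := (t : ℝ))
    (extendReal g) (σ : ℝ)
  rw [mul_zero] at h
  rw [← h]
  congr 1
  refine intervalIntegral.integral_congr fun s hs => ?_
  have hsI : s ∈ Icc (-1 : ℝ) 1 := by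
    refine uIcc_subset_Icc (by norm_num) t.2 hs
  have h2 := (scaleIcc σ ⟨s, hsI⟩).2
  change extendReal (g.comp (scaleIcc σ)) s = extendReal g (σ * s)
  rw [extendReal_of_mem _ hsI, extendReal_of_mem _ (t := σ * s) h2]
  rfl

/-- Constant functions on `[-1, 1]`, as a continuous linear map. -/
noncomputable def constIccCLM (E : Type*) [NormedAddCommGroup E] [NormedSpace ℝ E] :
    E →L[ℝ] C(Icc (-1 : ℝ) 1, E) :=
  LinearMap.mkContinuous
    { toFun := ContinuousMap.const _
      map_add' := fun _ _ => rfl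
      map_smul' := fun _ _ => rfl }
    1 fun x => (ContinuousMap.norm_le _ (by positivity)).2 fun _ => by
      rw [one_mul]
      exact le_rfl

lemma constIccCLM_apply (x : E) (t : Icc (-1 : ℝ) 1) : constIccCLM E x t = x := rfl

end Volterra

universe u in
/-- Smooth vector fields have smooth local flows. -/
lemma exists_contDiff_localFlow {E : Type u} [NormedAddCommGroup E] [NormedSpace ℝ E]
    [CompleteSpace E] {f : E → E} (hf : ContDiff ℝ ∞ f) (x₀ : E) :
    ∃ φ : ℝ × E → E, (∀ᶠ z in 𝓝 ((0 : ℝ), x₀), ContDiffAt ℝ ∞ φ z) ∧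
      (∀ᶠ x in 𝓝 x₀, φ (0, x) = x) ∧
      ∀ᶠ z in 𝓝 ((0 : ℝ), x₀), HasDerivAt (fun t => φ (t, z.2)) (f (φ z)) z.1 := by
  set N : C(Icc (-1 : ℝ) 1, E) → C(Icc (-1 : ℝ) 1, E) :=
    fun γ => (⟨f, hf.continuous⟩ : C(E, E)).comp γ with hNdef
  have hN : ContDiff ℝ ∞ N := contDiff_continuousMap_comp ⟨f, hf.continuous⟩ hf
  have hVN : ContDiff ℝ ∞ fun γ => volterra E (N γ) := hN.continuousLinearMap_comp (volterra E)
  set c₀ := constIccCLM E x₀ with hc₀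
  set G : (ℝ × E) × C(Icc (-1 : ℝ) 1, E) → C(Icc (-1 : ℝ) 1, E) :=
    fun w => w.2 - constIccCLM E w.1.2 - w.1.1 • volterra E (N w.2) with hG
  have hGs : ContDiff ℝ ∞ G := by
    have h1 : ContDiff ℝ ∞ fun w : (ℝ × E) × C(Icc (-1 : ℝ) 1, E) => volterra E (N w.2) :=
      hVN.comp contDiff_snd
    have h2 : ContDiff ℝ ∞ fun w : (ℝ × E) × C(Icc (-1 : ℝ) 1, E) => constIccCLM E w.1.2 :=
      (contDiff_snd.comp contDiff_fst).continuousLinearMap_comp (constIccCLM E)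
    exact (contDiff_snd.sub h2).sub ((contDiff_fst.comp contDiff_fst).smul h1)
  set H : (ℝ × E) × C(Icc (-1 : ℝ) 1, E) → (ℝ × E) × C(Icc (-1 : ℝ) 1, E) :=
    fun w => (w.1, G w) with hH
  have hHs : ContDiff ℝ ∞ H := contDiff_fst.prodMk hGs
  set p₀ : (ℝ × E) × C(Icc (-1 : ℝ) 1, E) := ((0, x₀), c₀) with hp₀
  set H' := ContinuousLinearEquiv.skewProd (ContinuousLinearEquiv.refl ℝ (ℝ × E))
    (ContinuousLinearEquiv.refl ℝ C(Icc (-1 : ℝ) 1, E))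
    (-(constIccCLM E).comp (ContinuousLinearMap.snd ℝ ℝ E)
      - (ContinuousLinearMap.fst ℝ ℝ E).smulRight (volterra E (N c₀)))
  have hH' : HasFDerivAt H
      (H' : (ℝ × E) × C(Icc (-1 : ℝ) 1, E) →L[ℝ] (ℝ × E) × C(Icc (-1 : ℝ) 1, E)) p₀ := by
    have h1 : HasFDerivAt (fun w : (ℝ × E) × C(Icc (-1 : ℝ) 1, E) => volterra E (N w.2)) _ p₀ :=
      (((hVN.comp contDiff_snd).differentiable (by simp)) p₀).hasFDerivAt
    have h2 : HasFDerivAt (fun w : (ℝ × E) × C(Icc (-1 : ℝ) 1, E) => w.1.1)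
      ((ContinuousLinearMap.fst ℝ ℝ E).comp (ContinuousLinearMap.fst ℝ _ _)) p₀ :=
      hasFDerivAt_fst.fst
    have h3 : HasFDerivAt (fun w : (ℝ × E) × C(Icc (-1 : ℝ) 1, E) => w.2 - constIccCLM E w.1.2)
      (ContinuousLinearMap.snd ℝ _ _ - (constIccCLM E).comp
        ((ContinuousLinearMap.snd ℝ ℝ E).comp (ContinuousLinearMap.fst ℝ _ _))) p₀ :=
      (ContinuousLinearMap.snd ℝ _ _ - (constIccCLM E).comp
        ((ContinuousLinearMap.snd ℝ ℝ E).comp (ContinuousLinearMap.fst ℝ _ _))).hasFDerivAt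
    refine (hasFDerivAt_fst.prodMk (h3.sub (h2.smul h1))).congr_fderiv ?_
    refine ContinuousLinearMap.ext fun w => Prod.ext rfl ?_
    simp [H', hp₀]
    abel
  obtain ⟨e, he, hp₀e, hes⟩ := exists_openPartialHomeomorph_contDiffAt_symm
    (Eventually.of_forall fun w => hHs.contDiffAt) hH'
  have hHp₀ : H p₀ = ((0, x₀), 0) := by
    simp [hH, hG, hp₀, hc₀]
  have hep₀ : e p₀ = ((0, x₀), 0) := by rw [he, hHp₀]
  rw [hHp₀] at hes
  have htend : Tendsto (fun z : ℝ × E => (z, (0 : C(Icc (-1 : ℝ) 1, E)))) (𝓝 (0, x₀))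
      (𝓝 ((0, x₀), 0)) := (Continuous.prodMk_left _).tendsto _
  set γ : ℝ × E → C(Icc (-1 : ℝ) 1, E) := fun z => (e.symm (z, 0)).2 with hγ
  have hγs : ∀ᶠ z in 𝓝 ((0 : ℝ), x₀), ContDiffAt ℝ ∞ γ z := by
    filter_upwards [htend.eventually hes] with z hz
    exact (hz.comp z (contDiff_prodMk_left _).contDiffAt).snd
  have hγfix : ∀ᶠ z in 𝓝 ((0 : ℝ), x₀),
      γ z = constIccCLM E z.2 + z.1 • volterra E (N (γ z)) := by
    have ht : ((0, x₀), 0) ∈ e.target := hep₀ ▸ e.map_source hp₀e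
    filter_upwards [htend.eventually (e.open_target.mem_nhds ht)] with z hz
    have h1 := e.right_inv hz
    rw [he] at h1
    have h2 : (e.symm (z, 0)).1 = z := congrArg Prod.fst h1
    have h3 : G (e.symm (z, 0)) = 0 := congrArg Prod.snd h1
    simp only [hG, h2] at h3
    rw [sub_sub, sub_eq_zero] at h3
    exact h3
  have hunique : ∀ w ∈ e.source, w.2 = constIccCLM E w.1.2 + w.1.1 • volterra E (N w.2) →
      γ w.1 = w.2 := by
    intro w hw h
    have h1 : e w = (w.1, 0) := by
      rw [he]
      refine Prod.ext rfl ?_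
      change w.2 - constIccCLM E w.1.2 - w.1.1 • volterra E (N w.2) = 0
      rw [sub_sub, sub_eq_zero]
      exact h
    simp only [hγ]
    rw [← h1, e.left_inv hw]
  have hγ₀ : γ (0, x₀) = c₀ := hunique p₀ hp₀e (by simp [hp₀, hc₀])
  let one : Icc (-1 : ℝ) 1 := ⟨1, by norm_num⟩
  refine ⟨fun z => γ z one, ?_, ?_, ?_⟩
  · filter_upwards [hγs] with z hz
    exact hz.continuousLinearMap_comp (ContinuousMap.evalCLM ℝ one)
  · have ht : Tendsto (fun x : E => ((0 : ℝ), x)) (𝓝 x₀) (𝓝 (0, x₀)) :=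
      (Continuous.prodMk_right _).tendsto _
    filter_upwards [ht.eventually hγfix] with x hx
    rw [hx]
    simp [constIccCLM_apply]
  · obtain ⟨r, hr, hrs⟩ := Metric.isOpen_iff.1 e.open_source p₀ hp₀e
    have hclose : ∀ᶠ z in 𝓝 ((0 : ℝ), x₀), dist (γ z) c₀ < r := by
      have := hγs.self_of_nhds.continuousAt.eventually_mem (Metric.ball_mem_nhds _ hr)
      rwa [hγ₀] at this
    obtain ⟨r', hr', hr's⟩ := Metric.eventually_nhds_iff.1 (hγfix.and hclose)
    obtain ⟨T, hT, hTr, hTr'⟩ : ∃ T > 0, T < r ∧ T < r' :=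
      ⟨min r r' / 2, by positivity, (half_lt_self (by positivity)).trans_le (min_le_left _ _),
        (half_lt_self (by positivity)).trans_le (min_le_right _ _)⟩
    filter_upwards [Metric.ball_mem_nhds ((0 : ℝ), x₀) hT] with z hz
    obtain ⟨t, x⟩ := z
    rw [Metric.mem_ball, Prod.dist_eq, max_lt_iff] at hz
    obtain ⟨ht, hx⟩ := hz
    simp only [dist_zero_right, Real.norm_eq_abs] at ht hx
    obtain ⟨hfix, hg⟩ := @hr's (T, x) (by
      rw [Prod.dist_eq, max_lt_iff]
      simp only [dist_zero_right, Real.norm_eq_abs, abs_of_pos hT]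
      exact ⟨hTr', hx.trans hTr'⟩)
    set g := γ (T, x) with hgdef
    have hscale : ∀ σ : Icc (-1 : ℝ) 1, γ (σ * T, x) = g.comp (scaleIcc σ) := by
      intro σ
      refine hunique ((σ * T, x), g.comp (scaleIcc σ)) (hrs ?_) ?_
      · rw [Metric.mem_ball, Prod.dist_eq, Prod.dist_eq, max_lt_iff, max_lt_iff]
        refine ⟨⟨?_, hx.trans hTr⟩, ?_⟩
        · simp only [hp₀, dist_zero_right, Real.norm_eq_abs, abs_mul, abs_of_pos hT]
          exact (mul_le_of_le_one_left hT.le (abs_le.2 σ.2)).trans_lt hTr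
        · refine lt_of_le_of_lt ((ContinuousMap.dist_le dist_nonneg).2 fun s => ?_) hg
          exact ContinuousMap.dist_apply_le_dist (f := g) (g := c₀) (scaleIcc σ s)
      · have h1 : N (g.comp (scaleIcc σ)) = (N g).comp (scaleIcc σ) := rfl
        have h2 := congrArg (fun k => k.comp (scaleIcc σ)) hfix
        simp only at h2 ⊢
        rw [h1, mul_comm, mul_smul, smul_volterra_comp_scaleIcc]
        exact h2
    have hφ : ∀ s : ℝ, |s| < T →
        γ (s, x) one = x + T • ∫ r in (0 : ℝ)..(T⁻¹ * s), extendReal (N g) r := by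
      intro s hs
      have hσ : T⁻¹ * s ∈ Icc (-1 : ℝ) 1 := by
        rw [mem_Icc, ← abs_le, abs_mul, abs_inv, abs_of_pos hT, inv_mul_le_iff₀ hT, mul_one]
        exact hs.le
      have h1 := hscale ⟨T⁻¹ * s, hσ⟩
      have h2 : T⁻¹ * s * T = s := by field_simp
      simp only [h2] at h1
      have h3 : scaleIcc ⟨T⁻¹ * s, hσ⟩ one = ⟨T⁻¹ * s, hσ⟩ :=
        Subtype.ext (mul_one _)
      have h4 := DFunLike.congr_fun hfix ⟨T⁻¹ * s, hσ⟩
      rw [h1, ContinuousMap.comp_apply, h3, h4]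
      rfl
    have hσ : T⁻¹ * t ∈ Icc (-1 : ℝ) 1 := by
      rw [mem_Icc, ← abs_le, abs_mul, abs_inv, abs_of_pos hT, inv_mul_le_iff₀ hT, mul_one]
      exact ht.le
    have hval : extendReal (N g) (T⁻¹ * t) = f (γ (t, x) one) := by
      rw [extendReal_of_mem _ hσ, hφ t ht]
      have h4 := DFunLike.congr_fun hfix ⟨T⁻¹ * t, hσ⟩
      exact congrArg f h4
    have hderiv : HasDerivAt
        (fun s : ℝ => x + T • ∫ r in (0 : ℝ)..(T⁻¹ * s), extendReal (N g) r)
        (T • T⁻¹ • extendReal (N g) (T⁻¹ * t)) t := by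
      have h1 := ((continuous_extendReal (N g)).integral_hasStrictDerivAt 0
        (T⁻¹ * t)).hasDerivAt
      have h2 : HasDerivAt (fun s : ℝ => T⁻¹ * s) T⁻¹ t := by
        simpa using (hasDerivAt_id t).const_mul T⁻¹
      exact ((h1.scomp t h2).const_smul T).const_add x
    rw [smul_inv_smul₀ hT.ne', hval] at hderiv
    refine hderiv.congr_of_eventuallyEq ?_
    filter_upwards [continuous_abs.continuousAt.eventually_lt_const ht] with s hs
    exact hφ s hs

/-- A smooth function has a smooth primitive along a direction `e` complemented by the kernel of a
functional `ℓ`. -/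
lemma exists_contDiff_fderiv_apply_eq {E : Type} [NormedAddCommGroup E] [NormedSpace ℝ E]
    (e : E) (ℓ : E →L[ℝ] ℝ) (he : ℓ e = 1) {g : E → ℝ} (hg : ContDiff ℝ ∞ g) :
    ∃ h : E → ℝ, ContDiff ℝ ∞ h ∧ ∀ y, fderiv ℝ h y e = g y := by
  let k : C(Icc (-1 : ℝ) 1, E) := ⟨fun s => (s : ℝ) • e, by fun_prop⟩
  let one : Icc (-1 : ℝ) 1 := ⟨1, by norm_num⟩
  let gc : C(E, ℝ) := ⟨g, hg.continuous⟩
  let seg : E → C(Icc (-1 : ℝ) 1, E) := fun y => constIccCLM E (y - ℓ y • e) + ℓ y • k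
  let h : E → ℝ := fun y => ℓ y * volterra ℝ (gc.comp (seg y)) one
  have hseg : ContDiff ℝ ∞ seg := by
    refine ContDiff.add (ContDiff.continuousLinearMap_comp (constIccCLM E) ?_) ?_
    · exact contDiff_id.sub (ℓ.contDiff.smul contDiff_const)
    · exact ℓ.contDiff.smul contDiff_const
  have hh : ContDiff ℝ ∞ h := by
    refine ℓ.contDiff.mul ?_
    exact (((contDiff_continuousMap_comp gc hg).comp hseg).continuousLinearMap_comp
      (volterra ℝ)).continuousLinearMap_comp (ContinuousMap.evalCLM ℝ one)
  have hint : ∀ y, h y = ∫ r in (0 : ℝ)..(ℓ y), g (y - ℓ y • e + r • e) := by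
    intro y
    have h1 := intervalIntegral.mul_integral_comp_mul_left (a := 0) (b := 1)
      (f := fun r => g (y - ℓ y • e + r • e)) (ℓ y)
    rw [mul_zero, mul_one] at h1
    rw [← h1]
    change ℓ y * ∫ s in (0 : ℝ)..1, extendReal (gc.comp (seg y)) s = _
    congr 1
    refine intervalIntegral.integral_congr fun s hs => ?_
    have hsI : s ∈ Icc (-1 : ℝ) 1 := uIcc_subset_Icc (by norm_num) (by norm_num) hs
    change extendReal (gc.comp (seg y)) s = g (y - ℓ y • e + (ℓ y * s) • e)
    rw [extendReal_of_mem _ hsI, mul_smul]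
    rfl
  refine ⟨h, hh, fun y => ?_⟩
  have hline : ∀ t : ℝ, h (y + t • e) = ∫ r in (0 : ℝ)..(ℓ y + t), g (y - ℓ y • e + r • e) := by
    intro t
    rw [hint, map_add, map_smul, he, smul_eq_mul, mul_one]
    congr 1
    ext r
    congr 2
    module
  have hd : HasDerivAt (fun t : ℝ => h (y + t • e)) (fderiv ℝ h y e) 0 :=
    (hh.differentiable (by simp) y).hasFDerivAt.hasLineDerivAt e
  have hc : Continuous fun r : ℝ => g (y - ℓ y • e + r • e) :=
    hg.continuous.comp (by fun_prop)
  have hd' : HasDerivAt (fun t : ℝ => h (y + t • e)) (g (y - ℓ y • e + (ℓ y + 0) • e)) 0 := by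
    simp only [hline]
    exact ((hc.integral_hasStrictDerivAt 0 (ℓ y + 0)).hasDerivAt).comp_const_add (ℓ y) 0
  rw [hd.unique hd']
  congr 1
  module

/-- A function whose derivative along `Pi.single i 1` vanishes near `0` does not depend on the
`i`-th coordinate near `0`. -/
lemma eventually_eq_sub_smul_single_of_fderiv_single_eq_zero {F : Type*} [NormedAddCommGroup F]
    [NormedSpace ℝ F] {ι : Type*} [Fintype ι] [DecidableEq ι] {f : (ι → ℝ) → F} (i : ι)
    (hf : Differentiable ℝ f) (h : ∀ᶠ y in 𝓝 0, fderiv ℝ f y (Pi.single i 1) = 0) :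
    ∀ᶠ y in 𝓝 0, f y = f (y - y i • Pi.single i 1) := by
  obtain ⟨r, hr, hrs⟩ := Metric.eventually_nhds_iff_ball.1 h
  filter_upwards [Metric.ball_mem_nhds (0 : ι → ℝ) hr] with y hy
  rw [mem_ball_zero_iff, pi_norm_lt_iff hr] at hy
  have key := Convex.norm_image_sub_le_of_norm_hasDerivWithin_le (s := Metric.ball (0 : ℝ) r)
    (f := fun t : ℝ => f (y - y i • Pi.single i 1 + t • Pi.single i 1))
    (f' := fun t => fderiv ℝ f (y - y i • Pi.single i 1 + t • Pi.single i 1) (Pi.single i 1))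
    (C := 0) (x := 0) (y := y i) (fun t _ => ?_) (fun t ht => ?_) (convex_ball _ _)
    (Metric.mem_ball_self hr) (by simpa using hy i)
  · rw [zero_mul, norm_le_zero_iff, sub_eq_zero] at key
    simpa using key
  · have h1 : HasDerivAt (fun t : ℝ => y - y i • Pi.single i 1 + t • Pi.single i (1 : ℝ))
        (Pi.single i 1) t := by
      simpa using ((hasDerivAt_id t).smul_const (Pi.single i (1 : ℝ) : ι → ℝ)).const_add
        (y - y i • Pi.single i 1)
    exact ((hf _).hasFDerivAt.comp_hasDerivAt t h1).hasDerivWithinAt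
  · rw [hrs _ ?_, norm_zero]
    rw [mem_ball_zero_iff, pi_norm_lt_iff hr] at *
    intro j
    by_cases hj : j = i
    · subst hj
      simpa using ht
    · simpa [hj] using hy j

/-- A one-form on `ℝ³` whose exterior derivative is annihilated by the last coordinate field is
locally of the form `df + a dψ`. -/
lemma exists_clebsch_of_contract_single_eq_zero
    {P : (Fin 3 → ℝ) → ((Fin 3 → ℝ) →L[ℝ] ℝ)} (hP : ContDiff ℝ ∞ P)
    (h : ∀ᶠ y in 𝓝 0, ∀ w, fderiv ℝ P y (Pi.single 2 1) w = fderiv ℝ P y w (Pi.single 2 1)) :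
    ∃ f a ψ : (Fin 3 → ℝ) → ℝ, ContDiff ℝ ∞ f ∧ ContDiff ℝ ∞ a ∧ ContDiff ℝ ∞ ψ ∧
      ∀ᶠ y in 𝓝 0, P y = fderiv ℝ f y + a y • fderiv ℝ ψ y := by
  obtain ⟨g, hg, hgP⟩ := exists_contDiff_fderiv_apply_eq (Pi.single (2 : Fin 3) (1 : ℝ))
    (ContinuousLinearMap.proj 2) (by simp)
    (hP.clm_apply (contDiff_const (c := Pi.single 2 1)))
  have hg' : ContDiff ℝ ∞ (fderiv ℝ g) := hg.fderiv_right (by simp)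
  set Q : (Fin 3 → ℝ) → ((Fin 3 → ℝ) →L[ℝ] ℝ) := fun y => P y - fderiv ℝ g y with hQdef
  have hQ : ContDiff ℝ ∞ Q := hP.sub hg'
  have hQ2 : ∀ y, Q y (Pi.single 2 1) = 0 := fun y => by simp [hQdef, hgP]
  have hQd : ∀ y v, fderiv ℝ Q y v = fderiv ℝ P y v - fderiv ℝ (fderiv ℝ g) y v := by
    intro y v
    rw [hQdef, fderiv_fun_sub (hP.differentiable (by simp) y) (hg'.differentiable (by simp) y)]
    rfl
  have hQ' : ∀ᶠ y in 𝓝 0, fderiv ℝ Q y (Pi.single 2 1) = 0 := by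
    filter_upwards [h] with y hy
    ext1 w
    have h1 : fderiv ℝ Q y w (Pi.single 2 1) = 0 := by
      have h2 : HasFDerivAt (fun y => Q y (Pi.single 2 1)) _ y :=
        (hQ.differentiable (by simp) y).hasFDerivAt.clm_apply (hasFDerivAt_const _ _)
      have h3 : HasFDerivAt (fun y => Q y (Pi.single 2 1)) (0 : (Fin 3 → ℝ) →L[ℝ] ℝ) y := by
        simp only [hQ2]
        exact hasFDerivAt_const _ _
      simpa using DFunLike.congr_fun (h2.unique h3) w
    have hsymm : IsSymmSndFDerivAt ℝ g y :=
      (contDiff_infty.1 hg 2).contDiffAt.isSymmSndFDerivAt (by simp)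
    rw [hQd] at h1 ⊢
    have h4 := hsymm (Pi.single 2 1) w
    simp only [sub_apply, zero_apply] at h1 ⊢
    rw [hy w, h4, h1]
  have hconst := eventually_eq_sub_smul_single_of_fderiv_single_eq_zero 2
    (hQ.differentiable (by simp)) hQ'
  obtain ⟨φ, hφ, hφQ⟩ := exists_contDiff_fderiv_apply_eq (Pi.single (0 : Fin 3) (1 : ℝ))
    (ContinuousLinearMap.proj 0) (by simp)
    (hQ.clm_apply (contDiff_const (c := Pi.single 0 1)))
  let pr : (Fin 3 → ℝ) →L[ℝ] (Fin 3 → ℝ) := ContinuousLinearMap.id ℝ _ -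
    (ContinuousLinearMap.proj 2 : (Fin 3 → ℝ) →L[ℝ] ℝ).smulRight (Pi.single 2 1)
  have hφpr : ContDiff ℝ ∞ fun y => φ (pr y) := hφ.comp pr.contDiff
  have hφpr' : ∀ y v, fderiv ℝ (fun y => φ (pr y)) y v = fderiv ℝ φ (pr y) (pr v) := by
    intro y v
    have hd : HasFDerivAt (fun y => φ (pr y)) _ y :=
      (hφ.differentiable (by simp) (pr y)).hasFDerivAt.comp y pr.hasFDerivAt
    rw [hd.fderiv]
    rfl
  have hpr0 : pr (Pi.single 0 1) = Pi.single 0 1 := by simp [pr]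
  have hpr2 : pr (Pi.single 2 1) = 0 := by simp [pr]
  let ψ : (Fin 3 → ℝ) →L[ℝ] ℝ := ContinuousLinearMap.proj 1
  refine ⟨fun y => g y + φ (pr y),
    fun y => Q y (Pi.single 1 1) - fderiv ℝ (fun y => φ (pr y)) y (Pi.single 1 1), ψ,
    hg.add hφpr, (hQ.clm_apply contDiff_const).sub
      ((hφpr.fderiv_right (by simp)).clm_apply contDiff_const), ψ.contDiff, ?_⟩
  filter_upwards [hconst] with y hy
  have hpry : pr y = y - y 2 • Pi.single 2 1 := rfl
  rw [← hpry] at hy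
  rw [fderiv_fun_add (hg.differentiable (by simp) y) (hφpr.differentiable (by simp) y),
    ψ.fderiv]
  have hPQ : ∀ v, P y v = fderiv ℝ g y v + Q y v := fun v => by simp [hQdef]
  refine ContinuousLinearMap.coe_injective ((Pi.basisFun ℝ (Fin 3)).ext fun i => ?_)
  simp only [Pi.basisFun_apply, ContinuousLinearMap.coe_coe, add_apply,
    smul_apply, smul_eq_mul]
  rw [hPQ, add_assoc]
  congr 1
  fin_cases i
  · simp [hφpr', hpr0, hφQ, hy, ψ]
  · simp [ψ]
  · simp [hφpr', hpr2, hQ2, ψ]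

/-- Derivative of the pullback of a one-form. -/
lemma fderiv_pullback_apply {E F : Type*} [NormedAddCommGroup E] [NormedSpace ℝ E]
    [NormedAddCommGroup F] [NormedSpace ℝ F] {α : F → (F →L[ℝ] ℝ)} {Φ : E → F} {y : E}
    (hα : DifferentiableAt ℝ α (Φ y)) (hΦ : ContDiffAt ℝ ∞ Φ y) (v w : E) :
    fderiv ℝ (fun y => (α (Φ y)).comp (fderiv ℝ Φ y)) y v w =
      fderiv ℝ α (Φ y) (fderiv ℝ Φ y v) (fderiv ℝ Φ y w)
        + α (Φ y) (fderiv ℝ (fderiv ℝ Φ) y v w) := by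
  have h1 := (hα.hasFDerivAt.comp y (hΦ.differentiableAt (by simp)).hasFDerivAt)
  have h2 := ((hΦ.fderiv_right (m := ∞) (by simp)).differentiableAt (by simp)).hasFDerivAt
  have h3 : HasFDerivAt (fun y => (α (Φ y)).comp (fderiv ℝ Φ y)) _ y := h1.clm_comp h2
  rw [h3.fderiv]
  simp [add_comm]

/-- The one-form on `ℝ³` with the components of a vector field. -/
noncomputable def oneFormOfField (p : (Fin 3 → ℝ) → (Fin 3 → ℝ)) (x : Fin 3 → ℝ) :
    (Fin 3 → ℝ) →L[ℝ] ℝ :=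
  ∑ i, p x i • ContinuousLinearMap.proj i

lemma oneFormOfField_apply (p : (Fin 3 → ℝ) → (Fin 3 → ℝ)) (x v : Fin 3 → ℝ) :
    oneFormOfField p x v = ∑ i, p x i * v i := by
  simp [oneFormOfField]

lemma contDiff_oneFormOfField {p : (Fin 3 → ℝ) → (Fin 3 → ℝ)} (hp : ContDiff ℝ ∞ p) :
    ContDiff ℝ ∞ (oneFormOfField p) :=
  ContDiff.sum fun i _ => (contDiff_pi.1 hp i).smul contDiff_const

lemma fderiv_apply_eq_sum_pd (f : (Fin 3 → ℝ) → ℝ) (x v : Fin 3 → ℝ) :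
    fderiv ℝ f x v = ∑ i, v i * pd i f x := by
  conv_lhs => rw [← Finset.univ_sum_single v]
  rw [map_sum]
  refine Finset.sum_congr rfl fun i _ => ?_
  rw [pd, ← smul_eq_mul, ← map_smul, ← Pi.single_smul, smul_eq_mul, mul_one]

/-- The curl annihilates the exterior derivative of the associated one-form. -/
lemma fderiv_oneFormOfField_curl3 {p : (Fin 3 → ℝ) → (Fin 3 → ℝ)} (hp : ContDiff ℝ ∞ p)
    (x w : Fin 3 → ℝ) :
    fderiv ℝ (oneFormOfField p) x (curl3 p x) w = fderiv ℝ (oneFormOfField p) x w (curl3 p x) := by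
  have key : ∀ v w, fderiv ℝ (oneFormOfField p) x v w
      = ∑ i, (∑ j, v j * pd j (fun y => p y i) x) * w i := by
    intro v w
    have h1 : HasFDerivAt (fun y => oneFormOfField p y w) _ x :=
      ((contDiff_oneFormOfField hp).differentiable (by simp) x).hasFDerivAt.clm_apply
        (hasFDerivAt_const w x)
    have h2 : HasFDerivAt (fun y => ∑ i, p y i * w i)
        (∑ i, w i • fderiv ℝ (fun y => p y i) x) x :=
      HasFDerivAt.fun_sum fun i _ =>
        (((contDiff_pi.1 hp i).differentiable (by simp) x).hasFDerivAt).mul_const (w i)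
    simp only [oneFormOfField_apply] at h1
    have h3 := DFunLike.congr_fun (h1.unique h2) v
    simp [fderiv_apply_eq_sum_pd] at h3
    rw [h3]
    simp [Fin.sum_univ_three]
    ring
  rw [key, key]
  simp [Fin.sum_univ_three, curl3]
  ring

lemma contDiff_curl3 {p : (Fin 3 → ℝ) → (Fin 3 → ℝ)} (hp : ContDiff ℝ ∞ p) :
    ContDiff ℝ ∞ (curl3 p) := by
  have h : ∀ i j, ContDiff ℝ ∞ (pd i fun y => p y j) := fun i j =>
    ((contDiff_pi.1 hp j).fderiv_right (by simp)).clm_apply contDiff_const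
  refine contDiff_pi.2 fun i => ?_
  fin_cases i
  · exact (h 1 2).sub (h 2 1)
  · exact (h 2 0).sub (h 0 2)
  · exact (h 0 1).sub (h 1 0)

/-- Straightening of a vector field near a point where it does not vanish. -/
lemma exists_flowBox {B : (Fin 3 → ℝ) → (Fin 3 → ℝ)} (hB : ContDiff ℝ ∞ B) {x₀ : Fin 3 → ℝ}
    (hx₀ : B x₀ ≠ 0) :
    ∃ (Φ : (Fin 3 → ℝ) → (Fin 3 → ℝ)) (L : (Fin 3 → ℝ) ≃L[ℝ] (Fin 3 → ℝ)), Φ 0 = x₀ ∧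
      (∀ᶠ y in 𝓝 0, ContDiffAt ℝ ∞ Φ y) ∧
      HasFDerivAt Φ (L : (Fin 3 → ℝ) →L[ℝ] (Fin 3 → ℝ)) 0 ∧
      ∀ᶠ y in 𝓝 0, fderiv ℝ Φ y (Pi.single 2 1) = B (Φ y) := by
  obtain ⟨φ, hφs, hφ0, hφd⟩ := exists_contDiff_localFlow hB x₀
  obtain ⟨L, hL⟩ := SeparatingDual.exists_continuousLinearEquiv_apply_eq (R := ℝ)
    (x := (Pi.single 2 1 : Fin 3 → ℝ)) (by simp) hx₀
  let ℓ : (Fin 3 → ℝ) →L[ℝ] ℝ := ContinuousLinearMap.proj 2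
  let e : Fin 3 → ℝ := Pi.single 2 1
  have hℓe : ℓ e = 1 := by simp [ℓ, e]
  let M : (Fin 3 → ℝ) →L[ℝ] (Fin 3 → ℝ) :=
    (L : (Fin 3 → ℝ) →L[ℝ] (Fin 3 → ℝ)).comp (ContinuousLinearMap.id ℝ _ - ℓ.smulRight e)
  have hM : ∀ y, M y = L y - ℓ y • B x₀ := fun y => by simp [M, e, hL]
  let j : (Fin 3 → ℝ) → ℝ × (Fin 3 → ℝ) := fun y => (ℓ y, x₀ + M y)
  have hj : ContDiff ℝ ∞ j := ℓ.contDiff.prodMk (contDiff_const.add M.contDiff)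
  have hj0 : j 0 = (0, x₀) := by simp [j]
  have hjt : Tendsto j (𝓝 0) (𝓝 (0, x₀)) := hj0 ▸ hj.continuous.tendsto 0
  have hΦs : ∀ᶠ y in 𝓝 0, ContDiffAt ℝ ∞ (fun y => φ (j y)) y := by
    filter_upwards [hjt.eventually hφs] with y hy
    exact hy.comp y hj.contDiffAt
  refine ⟨fun y => φ (j y), L, ?_, hΦs, ?_, ?_⟩
  · simp only [hj0]
    exact hφ0.self_of_nhds
  · have hD : HasFDerivAt φ (fderiv ℝ φ (0, x₀)) (j 0) := by
      rw [hj0]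
      exact (hφs.self_of_nhds.differentiableAt (by simp)).hasFDerivAt
    have hD1 : fderiv ℝ φ (0, x₀) (1, 0) = B x₀ := by
      have h1 := hφd.self_of_nhds
      rw [hφ0.self_of_nhds] at h1
      have h2 : HasFDerivAt φ (fderiv ℝ φ (0, x₀)) ((0 : ℝ), x₀) := hj0 ▸ hD
      exact (h2.comp_hasDerivAt (0 : ℝ)
        ((hasDerivAt_id (0 : ℝ)).prodMk (hasDerivAt_const (0 : ℝ) x₀))).unique h1
    have hD2 : ∀ v, fderiv ℝ φ (0, x₀) (0, v) = v := by
      intro v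
      have h2 : HasFDerivAt φ (fderiv ℝ φ (0, x₀)) ((0 : ℝ), x₀) := hj0 ▸ hD
      have h3 := h2.comp x₀ ((hasFDerivAt_const (0 : ℝ) x₀).prodMk (hasFDerivAt_id x₀))
      have h4 : HasFDerivAt (id : (Fin 3 → ℝ) → (Fin 3 → ℝ)) _ x₀ :=
        h3.congr_of_eventuallyEq (hφ0.mono fun x hx => hx.symm)
      simpa using DFunLike.congr_fun (h4.unique (hasFDerivAt_id x₀)) v
    have hj' : HasFDerivAt j (ℓ.prod M) 0 :=
      ℓ.hasFDerivAt.prodMk (M.hasFDerivAt.const_add x₀)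
    refine (hD.comp 0 hj').congr_fderiv (ContinuousLinearMap.ext fun v => ?_)
    have h5 : (ℓ v, M v) = ℓ v • ((1 : ℝ), (0 : Fin 3 → ℝ)) + (0, M v) := by simp
    change fderiv ℝ φ (0, x₀) (ℓ v, M v) = L v
    rw [h5, map_add, map_smul, hD1, hD2, hM]
    abel
  · filter_upwards [hΦs, hjt.eventually hφd] with y hy hd
    have h1 : HasDerivAt (fun t : ℝ => φ (j (y + t • e))) (fderiv ℝ (fun y => φ (j y)) y e) 0 :=
      (hy.differentiableAt (by simp)).hasFDerivAt.hasLineDerivAt e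
    have h2 : ∀ t : ℝ, j (y + t • e) = (ℓ y + t, x₀ + M y) := by
      intro t
      have hMe : M e = 0 := by rw [hM, hℓe, one_smul, hL, sub_self]
      simp [j, hℓe, hMe]
    have h3 : HasDerivAt (fun t : ℝ => φ (j (y + t • e))) (B (φ (j y))) 0 := by
      simp only [h2]
      refine HasDerivAt.comp_const_add (f := fun s => φ (s, x₀ + M y)) (ℓ y) 0 ?_
      rw [add_zero]
      exact hd
    exact h1.unique h3

/-- **Clebsch representation.** Near a point where its curl does not vanish, a smooth vector field
on `ℝ³` has the form `∇f + a ∇ψ`. -/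
lemma exists_clebsch {p : (Fin 3 → ℝ) → (Fin 3 → ℝ)} (hp : ContDiff ℝ ∞ p) {x₀ : Fin 3 → ℝ}
    (hcurl : curl3 p x₀ ≠ 0) :
    ∃ f a ψ : (Fin 3 → ℝ) → ℝ, ∀ᶠ x in 𝓝 x₀, ContDiffAt ℝ ∞ f x ∧ ContDiffAt ℝ ∞ a x ∧
      ContDiffAt ℝ ∞ ψ x ∧ ∀ i, p x i = pd i f x + a x * pd i ψ x := by
  obtain ⟨Φ, L, hΦ0, hΦs, hΦL, hΦB⟩ := exists_flowBox (contDiff_curl3 hp) hcurl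
  have hα := contDiff_oneFormOfField hp
  set α := oneFormOfField p with hαdef
  obtain ⟨P, hP, hPα⟩ := exists_contDiff_eventuallyEq (x₀ := (0 : Fin 3 → ℝ))
    (f := fun y => (α (Φ y)).comp (fderiv ℝ Φ y)) (by
      filter_upwards [hΦs] with y hy
      exact (hα.contDiffAt.comp y hy).clm_comp (hy.fderiv_right (by simp)))
  obtain ⟨f, a, ψ, hf, ha, hψ, hclebsch⟩ := exists_clebsch_of_contract_single_eq_zero hP (by
    filter_upwards [hPα.eventuallyEq_nhds, hΦs, hΦB] with y h1 h2 h3 w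
    have hsymm : IsSymmSndFDerivAt ℝ Φ y :=
      (contDiffAt_infty.1 h2 2).isSymmSndFDerivAt (by simp)
    rw [h1.fderiv_eq, fderiv_pullback_apply (hα.differentiable (by simp) _) h2,
      fderiv_pullback_apply (hα.differentiable (by simp) _) h2, h3,
      fderiv_oneFormOfField_curl3 hp, hsymm (Pi.single 2 1) w])
  obtain ⟨e, he, h0e, hes⟩ := exists_openPartialHomeomorph_contDiffAt_symm hΦs hΦL
  rw [hΦ0] at hes
  have he0 : e 0 = x₀ := by rw [he, hΦ0]
  have hx₀t : x₀ ∈ e.target := he0 ▸ e.map_source h0e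
  have htend : Tendsto e.symm (𝓝 x₀) (𝓝 0) := he0 ▸ e.tendsto_symm h0e
  refine ⟨fun x => f (e.symm x), fun x => a (e.symm x), fun x => ψ (e.symm x), ?_⟩
  filter_upwards [hes, e.open_target.eventually_mem hx₀t, htend.eventually hclebsch,
    htend.eventually hPα, htend.eventually hΦs] with x hx hxt h1 h2 h3
  have hinv : Φ (e.symm x) = x := by rw [← he, e.right_inv hxt]
  have hsd := (hx.differentiableAt (by simp)).hasFDerivAt
  have hcomp : ∀ k : (Fin 3 → ℝ) → ℝ, ContDiff ℝ ∞ k → ∀ i, pd i (fun x => k (e.symm x)) x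
      = fderiv ℝ k (e.symm x) (fderiv ℝ e.symm x (Pi.single i 1)) := by
    intro k hk i
    have h : HasFDerivAt (fun x => k (e.symm x)) _ x :=
      (hk.differentiable (by simp) _).hasFDerivAt.comp x hsd
    rw [pd, h.fderiv]
    rfl
  refine ⟨hf.contDiffAt.comp x hx, ha.contDiffAt.comp x hx, hψ.contDiffAt.comp x hx, fun i => ?_⟩
  rw [hcomp f hf, hcomp ψ hψ]
  have hid : fderiv ℝ Φ (e.symm x) (fderiv ℝ e.symm x (Pi.single i 1)) = Pi.single i 1 := by
    have h4 := (h3.differentiableAt (by simp)).hasFDerivAt.comp x hsd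
    have h5 : HasFDerivAt (id : (Fin 3 → ℝ) → (Fin 3 → ℝ)) _ x :=
      h4.congr_of_eventuallyEq (by
        filter_upwards [e.open_target.mem_nhds hxt] with z hz
        rw [Function.comp_apply, ← he, e.right_inv hz]
        rfl)
    exact DFunLike.congr_fun (h5.unique (hasFDerivAt_id x)) _
  have h6 : p x i = α x (Pi.single i 1) := by
    simp [hαdef, oneFormOfField_apply, Pi.single_apply]
  have h7 := DFunLike.congr_fun (h2.symm.trans h1) (fderiv ℝ e.symm x (Pi.single i 1))
  simp only [ContinuousLinearMap.comp_apply, hid, hinv] at h7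
  rw [h6, h7]
  rfl

/-- **Local reconstruction of a spinor phase decomposition from hydrodynamic data.**
If `ρ(x₀) > 0` and the canonical vorticity `∇×p` does not vanish at `x₀`, where
`p = m u + q A`, then on a neighborhood `U` of `x₀` there exist smooth positive densities
`ρ₁, ρ₂` with `ρ₁ + ρ₂ = ρ` and smooth phases `θ₁, θ₂` with
`(ρ₁/ρ) ∇(θ₁ - θ₂) + ∇θ₂ = m u + q A` on `U`. -/
theorem local_spinor_reconstruction
    (Ω : Set (Fin 3 → ℝ)) (hΩ : IsOpen Ω)
    (ρ : (Fin 3 → ℝ) → ℝ) (u A : (Fin 3 → ℝ) → (Fin 3 → ℝ)) (m q : ℝ) (hm : 0 < m)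
    (hρ : ContDiffOn ℝ (⊤ : ℕ∞) ρ Ω)
    (hu : ContDiffOn ℝ (⊤ : ℕ∞) u Ω)
    (hA : ContDiffOn ℝ (⊤ : ℕ∞) A Ω)
    (p : (Fin 3 → ℝ) → (Fin 3 → ℝ)) (hp : p = fun x i => m * u x i + q * A x i)
    (x₀ : Fin 3 → ℝ) (hx₀ : x₀ ∈ Ω)
    (hρ₀ : 0 < ρ x₀) (hcurl : curl3 p x₀ ≠ 0) :
    ∃ U : Set (Fin 3 → ℝ), IsOpen U ∧ x₀ ∈ U ∧ U ⊆ Ω ∧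
      ∃ ρ₁ ρ₂ θ₁ θ₂ : (Fin 3 → ℝ) → ℝ,
        ContDiffOn ℝ (⊤ : ℕ∞) ρ₁ U ∧ ContDiffOn ℝ (⊤ : ℕ∞) ρ₂ U ∧
        ContDiffOn ℝ (⊤ : ℕ∞) θ₁ U ∧ ContDiffOn ℝ (⊤ : ℕ∞) θ₂ U ∧
        ∀ x ∈ U,
          ρ₁ x + ρ₂ x = ρ x ∧ 0 < ρ₁ x ∧ 0 < ρ₂ x ∧
          ∀ i, ρ₁ x / ρ x * grad3 (fun y => θ₁ y - θ₂ y) x i + grad3 θ₂ x i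
              = m * u x i + q * A x i := by
  have hpΩ : ContDiffOn ℝ ∞ p Ω := by
    rw [hp]
    refine contDiffOn_pi.2 fun i => ?_
    exact (contDiffOn_const.mul (contDiffOn_pi.1 hu i)).add
      (contDiffOn_const.mul (contDiffOn_pi.1 hA i))
  have hnear : ∀ {F : Type} [NormedAddCommGroup F] [NormedSpace ℝ F] {g : (Fin 3 → ℝ) → F},
      ContDiffOn ℝ ∞ g Ω → ∀ᶠ x in 𝓝 x₀, ContDiffAt ℝ ∞ g x := by
    intro F _ _ g hg
    filter_upwards [hΩ.mem_nhds hx₀] with x hx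
    exact hg.contDiffAt (hΩ.mem_nhds hx)
  obtain ⟨p', hp', hpp'⟩ := exists_contDiff_eventuallyEq (hnear hpΩ)
  have hpd : ∀ i j, pd i (fun y => p' y j) x₀ = pd i (fun y => p y j) x₀ := fun i j => by
    have : (fun y => p' y j) =ᶠ[𝓝 x₀] fun y => p y j := hpp'.mono fun y hy => congrFun hy j
    rw [pd, pd, this.fderiv_eq]
  have hcurl' : curl3 p' x₀ ≠ 0 := by simpa only [curl3, hpd] using hcurl
  obtain ⟨f, a, ψ, hclebsch⟩ := exists_clebsch hp' hcurl'
  have ha : ContinuousAt a x₀ := hclebsch.self_of_nhds.2.1.continuousAt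
  have hagt : ∀ᶠ x in 𝓝 x₀, a x₀ - 1 / 2 < a x := ha.eventually_const_lt (by linarith)
  have halt : ∀ᶠ x in 𝓝 x₀, a x < a x₀ + 1 / 2 := ha.eventually_lt_const (by linarith)
  have hρpos : ∀ᶠ x in 𝓝 x₀, 0 < ρ x :=
    (hnear hρ).self_of_nhds.continuousAt.eventually_const_lt hρ₀
  obtain ⟨U, hU, hUo, hxU⟩ := eventually_nhds_iff.1 (hclebsch.and (hagt.and (halt.and (hρpos.and
    ((hnear hρ).and (hpp'.and (hΩ.mem_nhds hx₀)))))))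
  have hρd : ∀ x ∈ U, ContDiffAt ℝ ∞ ρ x := fun x hx => (hU x hx).2.2.2.2.1
  have hfd : ∀ x ∈ U, ContDiffAt ℝ ∞ f x := fun x hx => (hU x hx).1.1
  have had : ∀ x ∈ U, ContDiffAt ℝ ∞ a x := fun x hx => (hU x hx).1.2.1
  have hψd : ∀ x ∈ U, ContDiffAt ℝ ∞ ψ x := fun x hx => (hU x hx).1.2.2.1
  have hθ₂d : ∀ x ∈ U, ContDiffAt ℝ ∞ (fun y => f y + (a x₀ - 1 / 2) * ψ y) x := fun x hx =>
    (hfd x hx).add (contDiffAt_const.mul (hψd x hx))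
  refine ⟨U, hUo, hxU, fun x hx => (hU x hx).2.2.2.2.2.2,
    fun x => ρ x * (a x - a x₀ + 1 / 2), fun x => ρ x * (1 / 2 - (a x - a x₀)),
    fun x => f x + (a x₀ - 1 / 2) * ψ x + ψ x, fun x => f x + (a x₀ - 1 / 2) * ψ x,
    fun x hx => ((hρd x hx).mul (((had x hx).sub contDiffAt_const).add
      contDiffAt_const)).contDiffWithinAt,
    fun x hx => ((hρd x hx).mul (contDiffAt_const.sub ((had x hx).sub
      contDiffAt_const))).contDiffWithinAt,
    fun x hx => ((hθ₂d x hx).add (hψd x hx)).contDiffWithinAt,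
    fun x hx => (hθ₂d x hx).contDiffWithinAt, fun x hx => ?_⟩
  obtain ⟨⟨hf, -, hψ, hrep⟩, h1, h2, h3, -, h4, -⟩ := hU x hx
  refine ⟨by ring, mul_pos h3 (by linarith), mul_pos h3 (by linarith), fun i => ?_⟩
  have hpx : p' x i = m * u x i + q * A x i := by rw [h4, hp]
  have hgrad : grad3 (fun y => f y + (a x₀ - 1 / 2) * ψ y) x i
      = pd i f x + (a x₀ - 1 / 2) * pd i ψ x := by
    have h : HasFDerivAt (fun y => f y + (a x₀ - 1 / 2) * ψ y) _ x :=
      (hf.differentiableAt (by simp)).hasFDerivAt.add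
        ((hψ.differentiableAt (by simp)).hasFDerivAt.const_mul (a x₀ - 1 / 2))
    rw [grad3, pd, h.fderiv]
    rfl
  simp only [add_sub_cancel_left]
  rw [hgrad, ← hpx, hrep i, mul_div_cancel_left₀ _ h3.ne']
  simp only [grad3]
  ring

end
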